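/- Fix g > 0 and Δx, Δy > 0. Consider five cells indexed by α ∈ {C, W, E, S, N} with data h_α, B_α ∈ ℝ^K, qˣ_α = qʸ_α = 0, and 𝒫(h_α) invertible; assume the stochastic lake-at-rest condition h_α + B_α = c for a single constant vector c ∈ ℝ^K and all α. With interface averages h̄_E = (h_C + h_E)/2, h̄_W = (h_W + h_C)/2, h̄_N = (h_C + h_N)/2, h̄_S = (h_S + h_C)/2, and the corresponding averaged velocities all zero, one has −(𝓕ᴱᶜ_E − 𝓕ᴱᶜ_W)/Δx − (𝓖ᴱᶜ_N − 𝓖ᴱᶜ_S)/Δy + S_C = 0 in ℝ^{3K}, where S_C = (0, −(g/(2Δx))(𝒫(h̄_E)(B_E − B_C) + 𝒫(h̄_W)(B_C − B_W)), −(g/(2Δy))(𝒫(h̄_N)(B_N − B_C) + 𝒫(h̄_S)(B_C − B_S))). In other words, the energy-conservative finite volume scheme is well-balanced. -/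

import Mathlib

open Matrix

/-- The Galerkin triple-product matrix `𝒫(a)`, defined by
`(𝒫(a))_{l,m} = ∑ k, a k * T k l m`. -/
noncomputable def Pmat {K : ℕ} (T : Fin K → Fin K → Fin K → ℝ) (a : Fin K → ℝ) :
    Matrix (Fin K) (Fin K) ℝ :=
  Matrix.of fun l m => ∑ k, a k * T k l m

/-- A state `U = (h, qˣ, qʸ) ∈ ℝ^K × ℝ^K × ℝ^K`. -/
abbrev StateK (K : ℕ) := (Fin K → ℝ) × (Fin K → ℝ) × (Fin K → ℝ)

/-- Velocity coefficients `𝒫(h)⁻¹ q`. -/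
noncomputable def uvel {K : ℕ} (T : Fin K → Fin K → Fin K → ℝ) (h q : Fin K → ℝ) :
    Fin K → ℝ :=
  (Pmat T h)⁻¹ *ᵥ q

/-- The interface average `ā = (a_L + a_R)/2`. -/
noncomputable def avg {K : ℕ} (aL aR : Fin K → ℝ) : Fin K → ℝ :=
  (1 / 2 : ℝ) • (aL + aR)

/-- The energy-conservative numerical flux
`𝓕ᴱᶜ(U_L,U_R) = (𝒫(h̄)ū, ½g·overline{𝒫(h)h} + 𝒫(ū)𝒫(h̄)ū, 𝒫(v̄)𝒫(h̄)ū)`. -/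
noncomputable def FEC {K : ℕ} (T : Fin K → Fin K → Fin K → ℝ) (g : ℝ)
    (UL UR : StateK K) : StateK K :=
  let hb := avg UL.1 UR.1
  let ub := avg (uvel T UL.1 UL.2.1) (uvel T UR.1 UR.2.1)
  let vb := avg (uvel T UL.1 UL.2.2) (uvel T UR.1 UR.2.2)
  let phh := avg (Pmat T UL.1 *ᵥ UL.1) (Pmat T UR.1 *ᵥ UR.1)
  (Pmat T hb *ᵥ ub,
   ((1 / 2) * g) • phh + Pmat T ub *ᵥ (Pmat T hb *ᵥ ub),
   Pmat T vb *ᵥ (Pmat T hb *ᵥ ub))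

/-- The energy-conservative numerical flux
`𝓖ᴱᶜ(U_L,U_R) = (𝒫(h̄)v̄, 𝒫(ū)𝒫(h̄)v̄, ½g·overline{𝒫(h)h} + 𝒫(v̄)𝒫(h̄)v̄)`. -/
noncomputable def GEC {K : ℕ} (T : Fin K → Fin K → Fin K → ℝ) (g : ℝ)
    (UL UR : StateK K) : StateK K :=
  let hb := avg UL.1 UR.1
  let ub := avg (uvel T UL.1 UL.2.1) (uvel T UR.1 UR.2.1)
  let vb := avg (uvel T UL.1 UL.2.2) (uvel T UR.1 UR.2.2)
  let phh := avg (Pmat T UL.1 *ᵥ UL.1) (Pmat T UR.1 *ᵥ UR.1)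
  (Pmat T hb *ᵥ vb,
   Pmat T ub *ᵥ (Pmat T hb *ᵥ vb),
   ((1 / 2) * g) • phh + Pmat T vb *ᵥ (Pmat T hb *ᵥ vb))

section WellBalanced

variable {K : ℕ} {T : Fin K → Fin K → Fin K → ℝ}

theorem Pmat_add (T : Fin K → Fin K → Fin K → ℝ) (a b : Fin K → ℝ) :
    Pmat T (a + b) = Pmat T a + Pmat T b := by
  ext l m
  simp [Pmat, add_mul, Finset.sum_add_distrib]

theorem Pmat_smul (T : Fin K → Fin K → Fin K → ℝ) (r : ℝ) (a : Fin K → ℝ) :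
    Pmat T (r • a) = r • Pmat T a := by
  ext l m
  simp [Pmat, mul_assoc, Finset.mul_sum]

theorem Pmat_mulVec_comm (hT1 : ∀ k l m, T k l m = T l k m)
    (hT2 : ∀ k l m, T k l m = T k m l) (a b : Fin K → ℝ) :
    Pmat T a *ᵥ b = Pmat T b *ᵥ a := by
  ext l
  simp only [Pmat, mulVec, dotProduct, of_apply, Finset.sum_mul]
  rw [Finset.sum_comm]
  refine Finset.sum_congr rfl fun k _ => Finset.sum_congr rfl fun m _ => ?_
  rw [hT2 k l m, hT1 k m l, hT2 m k l]
  ring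

theorem Pmat_avg_mulVec_sub (hT1 : ∀ k l m, T k l m = T l k m)
    (hT2 : ∀ k l m, T k l m = T k m l) (a b : Fin K → ℝ) :
    Pmat T (avg a b) *ᵥ (a - b) = (1 / 2 : ℝ) • (Pmat T a *ᵥ a - Pmat T b *ᵥ b) := by
  rw [avg, Pmat_smul, Pmat_add, smul_mulVec, add_mulVec, mulVec_sub, mulVec_sub,
    Pmat_mulVec_comm hT1 hT2 b a]
  abel_nf

theorem FEC_at_rest (T : Fin K → Fin K → Fin K → ℝ) (g : ℝ) (a b : Fin K → ℝ) :
    FEC T g (a, 0, 0) (b, 0, 0) =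
      (0, ((1 / 2) * g) • avg (Pmat T a *ᵥ a) (Pmat T b *ᵥ b), 0) := by
  have h0 : avg (0 : Fin K → ℝ) 0 = 0 := by simp [avg]
  simp [FEC, uvel, h0]

theorem GEC_at_rest (T : Fin K → Fin K → Fin K → ℝ) (g : ℝ) (a b : Fin K → ℝ) :
    GEC T g (a, 0, 0) (b, 0, 0) =
      (0, 0, ((1 / 2) * g) • avg (Pmat T a *ᵥ a) (Pmat T b *ᵥ b)) := by
  have h0 : avg (0 : Fin K → ℝ) 0 = 0 := by simp [avg]
  simp [GEC, uvel, h0]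

/-- The one-dimensional balance between the pressure flux difference and the source term. -/
theorem pressure_source_balance (hT1 : ∀ k l m, T k l m = T l k m)
    (hT2 : ∀ k l m, T k l m = T k m l) (g d : ℝ) {hC hL hR BC BL BR c : Fin K → ℝ}
    (lakeC : hC + BC = c) (lakeL : hL + BL = c) (lakeR : hR + BR = c) :
    -(1 / d) • (((1 / 2) * g) • avg (Pmat T hC *ᵥ hC) (Pmat T hR *ᵥ hR)
        - ((1 / 2) * g) • avg (Pmat T hL *ᵥ hL) (Pmat T hC *ᵥ hC))
      + -(g / (2 * d)) • (Pmat T (avg hC hR) *ᵥ (BR - BC)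
        + Pmat T (avg hL hC) *ᵥ (BC - BL)) = 0 := by
  have hR' : BR - BC = hC - hR := by
    rw [sub_eq_sub_iff_add_eq_add, add_comm BR, lakeR, lakeC]
  have hL' : BC - BL = hL - hC := by
    rw [sub_eq_sub_iff_add_eq_add, add_comm BC, lakeC, lakeL]
  rw [hR', hL', Pmat_avg_mulVec_sub hT1 hT2, Pmat_avg_mulVec_sub hT1 hT2]
  ext i
  simp only [avg, Pi.add_apply, Pi.sub_apply, Pi.smul_apply, Pi.zero_apply, smul_eq_mul]
  ring

end WellBalanced

/-- the energy-conservative finite volume scheme is well-balanced at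
stochastic lake-at-rest data: with zero discharges and `h_α + B_α = c` in all five
cells, the flux differences exactly balance the source term. -/
theorem ec_scheme_well_balanced {K : ℕ} (hK : 1 ≤ K)
    (T : Fin K → Fin K → Fin K → ℝ)
    (hT1 : ∀ k l m, T k l m = T l k m) (hT2 : ∀ k l m, T k l m = T k m l)
    (g Δx Δy : ℝ) (hg : 0 < g) (hΔx : 0 < Δx) (hΔy : 0 < Δy)
    (hC hW hE hS hN BC BW BE BS BN c : Fin K → ℝ)
    (invC : IsUnit (Pmat T hC)) (invW : IsUnit (Pmat T hW))
    (invE : IsUnit (Pmat T hE)) (invS : IsUnit (Pmat T hS))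
    (invN : IsUnit (Pmat T hN))
    (lakeC : hC + BC = c) (lakeW : hW + BW = c) (lakeE : hE + BE = c)
    (lakeS : hS + BS = c) (lakeN : hN + BN = c) :
    -(1 / Δx) • (FEC T g (hC, 0, 0) (hE, 0, 0) - FEC T g (hW, 0, 0) (hC, 0, 0))
      - (1 / Δy) • (GEC T g (hC, 0, 0) (hN, 0, 0) - GEC T g (hS, 0, 0) (hC, 0, 0))
      + ((0 : Fin K → ℝ),
         -(g / (2 * Δx)) • (Pmat T (avg hC hE) *ᵥ (BE - BC)
            + Pmat T (avg hW hC) *ᵥ (BC - BW)),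
         -(g / (2 * Δy)) • (Pmat T (avg hC hN) *ᵥ (BN - BC)
            + Pmat T (avg hS hC) *ᵥ (BC - BS)))
      = (0 : StateK K) := by
  rw [FEC_at_rest, FEC_at_rest, GEC_at_rest, GEC_at_rest]
  refine Prod.ext ?_ (Prod.ext ?_ ?_)
  · simp
  · simpa using pressure_source_balance hT1 hT2 g Δx lakeC lakeW lakeE
  · simpa using pressure_source_balance hT1 hT2 g Δy lakeC lakeS lakeN
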